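/- arXiv:2604.26096 — 2 statements merged into one kernel-verified Lean document; each statement's English description precedes it below -/
import Mathlib

section
/- Let $\varphi\in C_0^\infty(\mathbb{R}^d)$ be nonnegative, radially symmetric, radially non-increasing with support in $\overline{B}_3(0)$. Then for any finite disjoint family $\mathfrak{B}$ of balls $B_{r_j}(x_j)$ with radii less than 1, $\big\|\sum_j \varphi_{x_j,r_j}\big\|_{W_2^d(\mathbb{R}^d)} \lesssim \big(\sum_j r_j^{-d}\big)^{1/2}$, where $W_2^d$ is the $L_2$-Sobolev space of order $d$ and $\varphi_{x,r}(y)=\varphi((y-x)/r)$. -/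
open Set MeasureTheory ENNReal Metric

noncomputable section

abbrev Euc (d : ℕ) := EuclideanSpace ℝ (Fin d)

lemma packing_pos (d : ℕ) (hd : 0 < d) : ∃ C : ℝ, 0 < C ∧ ∀ (n : ℕ) (x : Fin n → Euc d)
    (r : Fin n → ℝ), (∀ i, 0 < r i) →
    (Pairwise fun i j => Disjoint (ball (x i) (r i)) (ball (x j) (r j))) →
    ∀ (y : Euc d) (r0 : ℝ) (J : Finset (Fin n)), 0 < r0 →
      (∀ j ∈ J, r0 ≤ r j ∧ dist y (x j) ≤ 3 * r j) →
      ∑ j ∈ J, (r j)⁻¹ ^ d ≤ C * r0⁻¹ ^ d := by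
  set g : Euc d → ℝ := fun z => (1 + ‖z‖) ^ (-((2 * d : ℕ) : ℝ)) with hg
  have hgint : Integrable g volume := by
    apply integrable_one_add_norm
    rw [finrank_euclideanSpace_fin]
    exact_mod_cast (by omega : d < 2 * d)
  have hgnn : ∀ z, 0 ≤ g z := fun z => by positivity
  set v : ℝ := volume.real (ball (0 : Euc d) 1) with hv
  have hvpos : 0 < v := by
    apply ENNReal.toReal_pos
    · exact (measure_ball_pos volume _ one_pos).ne'
    · exact measure_ball_lt_top.ne
  set I : ℝ := ∫ z, g z with hI
  have hInn : 0 ≤ I := integral_nonneg hgnn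
  refine ⟨(I + 1) * 25 ^ d / v, by positivity, ?_⟩
  intro n x r hr hdis y r0 J hr0 hJ
  set G : Euc d → ℝ := fun z => g (r0⁻¹ • (z - y)) with hG
  have hGint : Integrable G volume := by
    have h1 : Integrable (fun z => g (r0⁻¹ • z)) volume :=
      hgint.comp_smul (inv_ne_zero hr0.ne')
    exact h1.comp_sub_right y
  have hGI : ∫ z, G z = r0 ^ d * I := by
    have h1 : ∫ z, G z = ∫ z, g (r0⁻¹ • z) :=
      integral_sub_right_eq_self (fun z => g (r0⁻¹ • z)) y
    rw [h1, Measure.integral_comp_smul, finrank_euclideanSpace_fin, smul_eq_mul, abs_of_pos (by positivity)]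
    simp [hI]
  have hlow : ∀ j ∈ J, v * (25 ^ d)⁻¹ * r0 ^ (2 * d) * (r j)⁻¹ ^ d ≤ ∫ z in ball (x j) (r j), G z := by
    intro j hj
    obtain ⟨h1, h2⟩ := hJ j hj
    have hrj := hr j
    have hvol : volume.real (ball (x j) (r j)) = r j ^ d * v := by
      rw [measureReal_def, Measure.addHaar_ball_of_pos _ _ hrj, ENNReal.toReal_mul,
        ENNReal.toReal_ofReal (by positivity), finrank_euclideanSpace_fin, hv, measureReal_def]
    have hc : ∀ z ∈ ball (x j) (r j), (r0 * (5 * r j)⁻¹) ^ (2 * d) ≤ G z := by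
      intro z hz
      have hzy : ‖z - y‖ ≤ 4 * r j := by
        rw [← dist_eq_norm]
        have := dist_triangle z (x j) y
        rw [mem_ball] at hz
        rw [dist_comm y] at h2
        linarith
      simp only [hG, hg]
      rw [Real.rpow_neg (by positivity), Real.rpow_natCast, ← inv_pow]
      apply pow_le_pow_left₀ (by positivity)
      rw [norm_smul, Real.norm_of_nonneg (by positivity)]
      rw [show r0 * (5 * r j)⁻¹ = (5 * r j / r0)⁻¹ by field_simp]
      apply inv_anti₀ (by positivity)
      rw [le_div_iff₀ hr0]
      field_simp
      linarith
    have := setIntegral_ge_of_const_le_real measurableSet_ball measure_ball_lt_top.ne hc hGint.integrableOn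
    rw [hvol] at this
    refine le_trans (le_of_eq ?_) this
    rw [pow_mul, pow_mul]
    have : (r0 * (5 * r j)⁻¹)^2 = 25⁻¹ * r0^2 * (r j)⁻¹^2 := by
      rw [mul_inv]; ring
    rw [this]
    have h3 : r j ^ d * (r j)⁻¹ ^ d = 1 := by
      rw [← mul_pow, mul_inv_cancel₀ hrj.ne', one_pow]
    simp only [mul_pow]
    rw [show ((r j)⁻¹ ^ 2) ^ d = (r j)⁻¹ ^ d * (r j)⁻¹ ^ d by rw [← pow_mul, ← pow_add]; congr 1; ring]
    rw [← inv_pow]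
    linear_combination (- v * 25⁻¹ ^ d * (r0 ^ 2) ^ d * (r j)⁻¹ ^ d) * h3
  have hsum : ∑ j ∈ J, ∫ z in ball (x j) (r j), G z ≤ r0 ^ d * I := by
    rw [← integral_biUnion_finset J (fun _ _ => measurableSet_ball) (fun i _ j _ hij => hdis hij)
      (fun _ _ => hGint.integrableOn), ← hGI]
    exact setIntegral_le_integral hGint (Filter.Eventually.of_forall fun z => hgnn _)
  have h := (Finset.sum_le_sum hlow).trans hsum
  rw [← Finset.mul_sum] at h
  set S := ∑ j ∈ J, (r j)⁻¹ ^ d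
  have hr0d : 0 < r0 ^ d := by positivity
  rw [two_mul, pow_add] at h
  have h' : v * (25 ^ d)⁻¹ * r0 ^ d * S ≤ I := by
    have : r0 ^ d * (v * (25 ^ d)⁻¹ * r0 ^ d * S) ≤ r0 ^ d * I := by linarith
    exact le_of_mul_le_mul_left this hr0d
  rw [inv_pow]
  rw [show (I + 1) * 25 ^ d / v * (r0 ^ d)⁻¹ = (I + 1) / (v * (25 ^ d)⁻¹ * r0 ^ d) by field_simp]
  rw [le_div_iff₀ (by positivity)]
  linarith

lemma packing (d : ℕ) : ∃ C : ℝ, 0 < C ∧ ∀ (n : ℕ) (x : Fin n → Euc d)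
    (r : Fin n → ℝ), (∀ i, 0 < r i) →
    (Pairwise fun i j => Disjoint (ball (x i) (r i)) (ball (x j) (r j))) →
    ∀ (y : Euc d) (r0 : ℝ) (J : Finset (Fin n)), 0 < r0 →
      (∀ j ∈ J, r0 ≤ r j ∧ dist y (x j) ≤ 3 * r j) →
      ∑ j ∈ J, (r j)⁻¹ ^ d ≤ C * r0⁻¹ ^ d := by
  rcases Nat.eq_zero_or_pos d with rfl | hd
  · refine ⟨1, one_pos, ?_⟩
    intro n x r hr hdis y r0 J hr0 hJ
    have : J.card ≤ 1 := by
      rw [Finset.card_le_one]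
      intro a _ b _
      by_contra hab
      have : Disjoint (ball (x a) (r a)) (ball (x b) (r b)) := hdis hab
      rw [Subsingleton.elim (x b) (x a)] at this
      exact Set.disjoint_left.1 this (mem_ball_self (hr a)) (mem_ball_self (hr b))
    simpa using this
  · exact packing_pos d hd

lemma pointwise_sq (d : ℕ) : ∃ C : ℝ, 0 < C ∧ ∀ (n : ℕ) (x : Fin n → Euc d)
    (r : Fin n → ℝ), (∀ i, 0 < r i) →
    (Pairwise fun i j => Disjoint (ball (x i) (r i)) (ball (x j) (r j))) →
    ∀ (y : Euc d),
      (∑ j, (closedBall (x j) (3 * r j)).indicator (fun _ => (r j)⁻¹ ^ d) y) ^ 2 ≤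
      C ^ 2 * ∑ j, (closedBall (x j) (3 * r j)).indicator (fun _ => ((r j)⁻¹ ^ d) ^ 2) y := by
  classical
  obtain ⟨C, hC, h⟩ := packing d
  refine ⟨C, hC, ?_⟩
  intro n x r hr hdis y
  simp only [Set.indicator_apply]
  rw [← Finset.sum_filter, ← Finset.sum_filter]
  set J := Finset.univ.filter (fun j => y ∈ closedBall (x j) (3 * r j)) with hJ
  rcases J.eq_empty_or_nonempty with he | hne
  · simp [he]
  obtain ⟨i, hi, hmin⟩ := J.exists_min_image r hne
  have hb := h n x r hr hdis y (r i) J (hr i) (fun j hj => ⟨hmin j hj, by simpa [hJ] using hj⟩)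
  have hnn : ∀ j, 0 ≤ (r j)⁻¹ ^ d := fun j => by have := hr j; positivity
  calc _ ≤ (C * (r i)⁻¹ ^ d) ^ 2 := pow_le_pow_left₀ (Finset.sum_nonneg fun j _ => hnn j) hb 2
    _ = C ^ 2 * ((r i)⁻¹ ^ d) ^ 2 := by ring
    _ ≤ _ := by
      gcongr
      exact Finset.single_le_sum (f := fun j => ((r j)⁻¹ ^ d) ^ 2) (fun j _ => by positivity) hi

lemma deriv_bound (d : ℕ) (φ : Euc d → ℝ)
    (hsmooth : ContDiff ℝ (⊤ : ℕ∞) φ)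
    (hsupp : Function.support φ ⊆ closedBall 0 3) (k : ℕ) (hk : k ≤ d) :
    ∃ M : ℝ, 0 < M ∧ ∀ (n : ℕ) (x : Fin n → Euc d) (r : Fin n → ℝ),
      (∀ i, 0 < r i) → (∀ i, r i < 1) → ∀ y,
      ‖iteratedFDeriv ℝ k (fun z => ∑ i : Fin n, φ ((r i)⁻¹ • (z - x i))) y‖ ≤
      M * ∑ j, (closedBall (x j) (3 * r j)).indicator (fun _ => (r j)⁻¹ ^ d) y := by
  classical
  have hts : tsupport φ ⊆ closedBall 0 3 := closure_minimal hsupp isClosed_closedBall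
  have hcs : HasCompactSupport φ :=
    (isCompact_closedBall (0 : Euc d) 3).of_isClosed_subset isClosed_closure hts
  have hk' : ContDiff ℝ (k : ℕ) φ := hsmooth.of_le (by exact_mod_cast le_top)
  obtain ⟨M, hM⟩ := (hcs.iteratedFDeriv (𝕜 := ℝ) k).exists_bound_of_continuous
    (hk'.continuous_iteratedFDeriv le_rfl)
  refine ⟨|M| + 1, by positivity, ?_⟩
  intro n x r hr hr1 y
  rw [iteratedFDeriv_fun_sum_apply (fun j _ => by
    apply ContDiff.contDiffAt
    exact hk'.comp (by fun_prop))]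
  refine (norm_sum_le _ _).trans ?_
  rw [Finset.mul_sum]
  apply Finset.sum_le_sum
  intro j _
  have hrj := hr j
  have e : iteratedFDeriv ℝ k (fun z => φ ((r j)⁻¹ • (z - x j))) y =
      (r j)⁻¹ ^ k • iteratedFDeriv ℝ k φ ((r j)⁻¹ • (y - x j)) := by
    rw [iteratedFDeriv_comp_sub (f := fun z => φ ((r j)⁻¹ • z)), iteratedFDeriv_comp_const_smul _ hk']
  rw [e, norm_smul, Real.norm_of_nonneg (by positivity)]
  by_cases hy : y ∈ closedBall (x j) (3 * r j)
  · rw [indicator_of_mem hy, mul_comm]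
    gcongr
    · exact (hM _).trans ((le_abs_self M).trans (by linarith))
    · exact (one_le_inv₀ hrj).2 (hr1 j).le
  · rw [indicator_of_notMem hy]
    have : iteratedFDeriv ℝ k φ ((r j)⁻¹ • (y - x j)) = 0 := by
      by_contra hne
      apply hy
      have := hts (support_iteratedFDeriv_subset (𝕜 := ℝ) k hne)
      rw [mem_closedBall_zero_iff, norm_smul, Real.norm_of_nonneg (by positivity),
        inv_mul_le_iff₀ hrj] at this
      rw [mem_closedBall, dist_eq_norm]; linarith
    simp [this]

lemma single_bound (d : ℕ) (φ : Euc d → ℝ)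
    (hsmooth : ContDiff ℝ (⊤ : ℕ∞) φ)
    (hsupp : Function.support φ ⊆ closedBall 0 3) (k : ℕ) (hk : k ≤ d) :
    ∃ C : ℝ, 0 < C ∧ ∀ (n : ℕ) (x : Fin n → Euc d) (r : Fin n → ℝ),
      (∀ i, 0 < r i) → (∀ i, r i < 1) →
      (Pairwise fun i j => Disjoint (ball (x i) (r i)) (ball (x j) (r j))) →
          eLpNorm (fun y =>
            ‖iteratedFDeriv ℝ k (fun z => ∑ i : Fin n, φ ((r i)⁻¹ • (z - x i))) y‖) 2 volume
        ≤ ENNReal.ofReal C * ENNReal.ofReal (∑ i : Fin n, r i ^ (-(d : ℝ))) ^ (1/2 : ℝ) := by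
  obtain ⟨C, hC, hsq⟩ := pointwise_sq d
  obtain ⟨M, hM, hder⟩ := deriv_bound d φ hsmooth hsupp k hk
  set v : ℝ := volume.real (ball (0 : Euc d) 1) with hv
  have hvpos : 0 < v := by
    apply ENNReal.toReal_pos
    · exact (measure_ball_pos volume _ one_pos).ne'
    · exact measure_ball_lt_top.ne
  set K : ℝ := M ^ 2 * C ^ 2 * (3 ^ d * v) with hK
  have hKpos : 0 < K := by positivity
  refine ⟨K ^ (1/2 : ℝ), by positivity, ?_⟩
  intro n x r hr hr1 hdis
  rw [eLpNorm_eq_lintegral_rpow_enorm_toReal (by norm_num) (by norm_num),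
    ← ENNReal.ofReal_rpow_of_pos hKpos, ← ENNReal.mul_rpow_of_nonneg _ _ (by norm_num)]
  simp only [ENNReal.toReal_ofNat]
  apply ENNReal.rpow_le_rpow _ (by norm_num)
  calc _ ≤ ∫⁻ y : Euc d, ∑ j, ENNReal.ofReal (M ^ 2 * C ^ 2) *
        (closedBall (x j) (3 * r j)).indicator (fun _ => ENNReal.ofReal (((r j)⁻¹ ^ d) ^ 2)) y := by
        apply lintegral_mono
        intro y
        have h1 := pow_le_pow_left₀ (norm_nonneg _) (hder n x r hr hr1 y) 2
        have h2 := hsq n x r hr hdis y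
        simp only [enorm_norm]
        rw [← ofReal_norm, ENNReal.ofReal_rpow_of_nonneg (norm_nonneg _) (by norm_num), Real.rpow_ofNat]
        rw [← Finset.mul_sum]
        have h3 : ∀ j, (closedBall (x j) (3 * r j)).indicator
            (fun _ => ENNReal.ofReal (((r j)⁻¹ ^ d) ^ 2)) y = ENNReal.ofReal
            ((closedBall (x j) (3 * r j)).indicator (fun _ => ((r j)⁻¹ ^ d) ^ 2) y) := by
          intro j
          by_cases hy : y ∈ closedBall (x j) (3 * r j)
          · simp [indicator_of_mem hy]
          · simp [indicator_of_notMem hy]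
        simp only [h3]
        rw [← ENNReal.ofReal_sum_of_nonneg (fun j _ => indicator_nonneg (fun _ _ => by positivity) y),
          ← ENNReal.ofReal_mul (by positivity)]
        apply ENNReal.ofReal_le_ofReal
        refine h1.trans ?_
        rw [mul_pow, mul_assoc]
        gcongr
    _ = ∑ j, ENNReal.ofReal (M ^ 2 * C ^ 2) * (ENNReal.ofReal (((r j)⁻¹ ^ d) ^ 2) *
          volume (closedBall (x j) (3 * r j))) := by
        rw [lintegral_finsetSum _ (fun j _ =>
          (measurable_const.indicator measurableSet_closedBall).const_mul _)]
        refine Finset.sum_congr rfl fun j _ => ?_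
        rw [lintegral_const_mul _ (measurable_const.indicator measurableSet_closedBall),
          lintegral_indicator_const measurableSet_closedBall]
    _ = ∑ j, ENNReal.ofReal (K * r j ^ (-(d : ℝ))) := by
        refine Finset.sum_congr rfl fun j _ => ?_
        have hrj := hr j
        rw [Measure.addHaar_closedBall _ _ (by positivity), finrank_euclideanSpace_fin,
          ← ENNReal.ofReal_toReal (a := volume (ball (0 : Euc d) 1)) measure_ball_lt_top.ne,
          ← measureReal_def, ← hv, ← ENNReal.ofReal_mul (by positivity),
          ← ENNReal.ofReal_mul (by positivity), ← ENNReal.ofReal_mul (by positivity)]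
        congr 1
        rw [Real.rpow_neg hrj.le, Real.rpow_natCast, ← inv_pow, hK, mul_pow]
        have h3 : r j ^ d * (r j)⁻¹ ^ d = 1 := by
          rw [← mul_pow, mul_inv_cancel₀ hrj.ne', one_pow]
        linear_combination (M ^ 2 * C ^ 2 * 3 ^ d * v * (r j)⁻¹ ^ d) * h3
    _ = _ := by
        rw [← ENNReal.ofReal_sum_of_nonneg (fun j _ => by have := hr j; positivity), ← Finset.mul_sum,
          ENNReal.ofReal_mul hKpos.le]

/-- For a nonnegative, radially symmetric, radially non-increasing `φ ∈ C_0^∞(ℝ^d)`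
supported in `closedBall 0 3`, and any finite disjoint family of balls `B_{r_j}(x_j)` with
radii `r_j < 1`, one has `‖∑_j φ((· - x_j)/r_j)‖_{W_2^d} ≲ (∑_j r_j^{-d})^{1/2}`,
where the `W_2^d` norm is the sum of the `L_2` norms of the derivatives of order `≤ d`. -/
theorem stmt12 (d : ℕ) (φ : Euc d → ℝ)
    (hsmooth : ContDiff ℝ (⊤ : ℕ∞) φ)
    (hsupp : Function.support φ ⊆ closedBall 0 3)
    (hpos : ∀ y, 0 ≤ φ y)
    (hrad : ∀ y z : Euc d, ‖y‖ = ‖z‖ → φ y = φ z)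
    (hmono : ∀ y z : Euc d, ‖y‖ ≤ ‖z‖ → φ z ≤ φ y) :
    ∃ C : ℝ, 0 < C ∧ ∀ (n : ℕ) (x : Fin n → Euc d) (r : Fin n → ℝ),
      (∀ i, 0 < r i) → (∀ i, r i < 1) →
      (Pairwise fun i j => Disjoint (ball (x i) (r i)) (ball (x j) (r j))) →
      ∑ k ∈ Finset.range (d + 1),
          eLpNorm (fun y =>
            ‖iteratedFDeriv ℝ k (fun z => ∑ i : Fin n, φ ((r i)⁻¹ • (z - x i))) y‖) 2 volume
        ≤ ENNReal.ofReal C * ENNReal.ofReal (∑ i : Fin n, r i ^ (-(d : ℝ))) ^ (1/2 : ℝ) := by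
  have key : ∀ k : ℕ, ∃ C : ℝ, 0 < C ∧ (k ≤ d → ∀ (n : ℕ) (x : Fin n → Euc d) (r : Fin n → ℝ),
      (∀ i, 0 < r i) → (∀ i, r i < 1) →
      (Pairwise fun i j => Disjoint (ball (x i) (r i)) (ball (x j) (r j))) →
          eLpNorm (fun y =>
            ‖iteratedFDeriv ℝ k (fun z => ∑ i : Fin n, φ ((r i)⁻¹ • (z - x i))) y‖) 2 volume
        ≤ ENNReal.ofReal C * ENNReal.ofReal (∑ i : Fin n, r i ^ (-(d : ℝ))) ^ (1/2 : ℝ)) := by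
    intro k
    by_cases hk : k ≤ d
    · obtain ⟨C, hC, h⟩ := single_bound d φ hsmooth hsupp k hk
      exact ⟨C, hC, fun _ => h⟩
    · exact ⟨1, one_pos, fun h => absurd h hk⟩
  choose C hC h using key
  refine ⟨∑ k ∈ Finset.range (d + 1), C k, Finset.sum_pos (fun k _ => hC k) (by simp), ?_⟩
  intro n x r hr hr1 hdis
  rw [ENNReal.ofReal_sum_of_nonneg (fun k _ => (hC k).le), Finset.sum_mul]
  refine Finset.sum_le_sum fun k hk => ?_
  exact h k (Nat.lt_succ_iff.1 (Finset.mem_range.1 hk)) n x r hr hr1 hdis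
end
end

section
/- (Frostman-type lemma for Netrusov–Hausdorff capacities.) Let $\varphi$ be a bounded radially symmetric, radially non-increasing function with support exactly $\overline{B}_3(0)$, and let $\mu$ be a signed measure of bounded variation on $\mathbb{R}^d$. Suppose that for every finite disjoint family $\mathfrak{B}$ of balls $B_{r_j}(x_j)$ with radii less than 1, $\big|\sum_j\int\varphi_{x_j,r_j}\,d\mu\big|\lesssim\big(\|\{r_j\}\|_{\ell_{\alpha,q}}^q\big)^\gamma$. Then $|\mu|(A)\lesssim \mathcal{H}_{\alpha,q/\alpha}(A)^\gamma$ for every Borel set $A\subset\mathbb{R}^d$. -/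
open Set MeasureTheory ENNReal

noncomputable section

/-- The dyadic block `∑_{diam B_j ∈ [2^{-k-1}, 2^{-k})} (diam B_j)^α` of a covering. -/
def dyadicBlock {d : ℕ} (α : ℝ) (B : ℕ → Set (Euc d)) (k : ℤ) : ℝ≥0∞ :=
  ∑' j : ℕ, (Set.Ico ((2 : ℝ≥0∞) ^ (-k - 1)) ((2 : ℝ≥0∞) ^ (-k))).indicator
    (fun t => t ^ α) (EMetric.diam (B j))

/-- The Netrusov--Hausdorff capacity `𝓗_{α,q}` for finite `q`:
`𝓗_{α,q}(F) = lim_{δ→0} inf { ∑_k (∑_{diam B_j ∈ Δ_k} (diam B_j)^α)^q :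
F ⊆ ⋃ B_j, diam B_j < δ }`. -/
def NHfin (d : ℕ) (α q : ℝ) (F : Set (Euc d)) : ℝ≥0∞ :=
  ⨆ (δ : ℝ≥0∞) (_ : 0 < δ),
    ⨅ (B : ℕ → Set (Euc d)) (_ : F ⊆ ⋃ j, B j) (_ : ∀ j, EMetric.diam (B j) < δ),
      ∑' k : ℤ, (dyadicBlock α B k) ^ q

/-- The Netrusov--Hausdorff capacity `𝓗_{α,∞}`, with the outer sum over dyadic scales
replaced by a supremum. -/
def NHinf (d : ℕ) (α : ℝ) (F : Set (Euc d)) : ℝ≥0∞ :=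
  ⨆ (δ : ℝ≥0∞) (_ : 0 < δ),
    ⨅ (B : ℕ → Set (Euc d)) (_ : F ⊆ ⋃ j, B j) (_ : ∀ j, EMetric.diam (B j) < δ),
      ⨆ k : ℤ, dyadicBlock α B k

/-- The counting distribution function of a finite family of reals. -/
def distCount {ι : Type*} (a : ι → ℝ) (t : ℝ) : ℝ≥0∞ :=
  ∑' j : ι, ({j : ι | t ≤ |a j|}).indicator (fun _ => (1 : ℝ≥0∞)) j

/-- The Lorentz sequence quasi-norm `‖a‖_{ℓ_{p,q}}`. -/
def lorentzSeqNorm {ι : Type*} (p q : ℝ) (a : ι → ℝ) : ℝ≥0∞ :=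
  (ENNReal.ofReal q * ∫⁻ t in Set.Ioi (0 : ℝ),
    (distCount a t * ENNReal.ofReal t ^ p) ^ (q / p) * (ENNReal.ofReal t)⁻¹) ^ (1 / q)

/-- The integral of a function against a signed measure, via the Jordan decomposition. -/
def signedIntegral {d : ℕ} (s : SignedMeasure (Euc d)) (g : Euc d → ℝ) : ℝ :=
  (∫ y, g y ∂s.toJordanDecomposition.posPart) - ∫ y, g y ∂s.toJordanDecomposition.negPart

/-- Hardy-type inequality for geometric convolutions. -/
theorem hardy_geom (θ : ℝ≥0∞) (hθ : θ < 1) (p : ℝ) (hp : 0 < p) :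
    ∃ K : ℝ≥0∞, K ≠ ⊤ ∧ ∀ b : ℤ → ℝ≥0∞,
      ∑' m : ℤ, (∑' j : ℕ, θ ^ j * b (m + 1 - j)) ^ p ≤ K * ∑' k : ℤ, (b k) ^ p := by
  set η : ℝ≥0∞ := θ ^ (1 / 2 : ℝ) with hη
  have hηη : η * η = θ := by
    rw [hη, ← ENNReal.rpow_add_of_nonneg _ _ (by norm_num) (by norm_num)]
    norm_num
  have hη1 : η < 1 := ENNReal.rpow_lt_one hθ (by norm_num)
  have hηp : η ^ p < 1 := ENNReal.rpow_lt_one hη1 hp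
  refine ⟨((1 - η)⁻¹) ^ p * (1 - η ^ p)⁻¹, ?_, ?_⟩
  · apply ENNReal.mul_ne_top
    · apply ENNReal.rpow_ne_top_of_nonneg hp.le
      simpa [tsub_eq_zero_iff_le] using hη1
    · simpa [tsub_eq_zero_iff_le] using hηp
  intro b
  have key : ∀ x : ℕ → ℝ≥0∞, (∑' j : ℕ, θ ^ j * x j) ^ p ≤
      ((1 - η)⁻¹) ^ p * ∑' j : ℕ, (η ^ p) ^ j * (x j) ^ p := by
    intro x
    set T := ∑' j : ℕ, (η ^ p) ^ j * (x j) ^ p with hT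
    have h1 : ∀ j, η ^ j * x j ≤ T ^ (1 / p) := by
      intro j
      rw [one_div, ENNReal.le_rpow_inv_iff hp, ENNReal.mul_rpow_of_nonneg _ _ hp.le]
      have : (η ^ j) ^ p = (η ^ p) ^ j := by
        clear_value η
        rw [← ENNReal.rpow_natCast, ← ENNReal.rpow_natCast, ← ENNReal.rpow_mul,
          ← ENNReal.rpow_mul, mul_comm]
      rw [this]
      exact ENNReal.le_tsum j
    have h2 : ∑' j : ℕ, θ ^ j * x j ≤ (1 - η)⁻¹ * T ^ (1 / p) := by
      rw [← ENNReal.tsum_geometric, ← ENNReal.tsum_mul_right]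
      apply ENNReal.tsum_le_tsum
      intro j
      rw [← hηη, mul_pow, mul_assoc]
      gcongr
      exact h1 j
    calc _ ≤ ((1 - η)⁻¹ * T ^ (1 / p)) ^ p := by gcongr
      _ = _ := by
        rw [ENNReal.mul_rpow_of_nonneg _ _ hp.le, ← ENNReal.rpow_mul, one_div,
          inv_mul_cancel₀ hp.ne', ENNReal.rpow_one]
  calc _ ≤ ∑' m : ℤ, ((1 - η)⁻¹) ^ p * ∑' j : ℕ, (η ^ p) ^ j * (b (m + 1 - j)) ^ p :=
        ENNReal.tsum_le_tsum fun m => key _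
    _ = ((1 - η)⁻¹) ^ p * ∑' j : ℕ, (η ^ p) ^ j * ∑' m : ℤ, (b (m + 1 - j)) ^ p := by
        rw [ENNReal.tsum_mul_left, ENNReal.tsum_comm]
        simp_rw [ENNReal.tsum_mul_left]
    _ = ((1 - η)⁻¹) ^ p * ∑' j : ℕ, (η ^ p) ^ j * ∑' m : ℤ, (b m) ^ p := by
        congr 1
        refine tsum_congr fun j => ?_
        congr 1
        have := (Equiv.addRight (1 - (j : ℤ))).tsum_eq (fun m => (b m) ^ p)
        rw [← this]
        refine tsum_congr fun m => ?_
        simp [add_sub_assoc]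
    _ = _ := by rw [ENNReal.tsum_mul_right, ENNReal.tsum_geometric, mul_assoc]

/-- Dyadic block of a sequence of diameters. -/
def blk (α : ℝ) (ρ : ℕ → ℝ≥0∞) (k : ℤ) : ℝ≥0∞ :=
  ∑' j : ℕ, (Set.Ico ((2 : ℝ≥0∞) ^ (-k - 1)) ((2 : ℝ≥0∞) ^ (-k))).indicator
    (fun t => t ^ α) (ρ j)

theorem zpow_real_ennreal (m : ℤ) : ENNReal.ofReal ((2 : ℝ) ^ m) = (2 : ℝ≥0∞) ^ m := by
  rw [← Real.rpow_intCast, ← ENNReal.rpow_intCast, ← ENNReal.ofReal_rpow_of_pos (by norm_num)]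
  norm_num

theorem dist_bound (α : ℝ) (hα : 0 < α) (ρ : ℕ → ℝ≥0∞) (hρ : ∀ j, ρ j ≠ ⊤) (n : ℕ)
    (e : Fin n → ℕ) (he : Function.Injective e) (h0 : ∀ i, ρ (e i) ≠ 0) (m : ℤ) (t : ℝ)
    (ht : (2 : ℝ) ^ (-m - 1) ≤ t) (ht' : t < (2 : ℝ) ^ (-m)) :
    distCount (fun i => 2 * (ρ (e i)).toReal) t * ENNReal.ofReal t ^ α ≤
      (2 : ℝ≥0∞) ^ (2 * α) * ∑' j : ℕ, ((2 : ℝ≥0∞) ^ (-α)) ^ j * blk α ρ (m + 1 - j) := by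
  have h1 : ∀ i, ({j : Fin n | t ≤ |2 * (ρ (e j)).toReal|}).indicator (fun _ => (1 : ℝ≥0∞)) i
      * ENNReal.ofReal t ^ α ≤ (2 : ℝ≥0∞) ^ (2 * α) * ∑' j : ℕ, ((2 : ℝ≥0∞) ^ (-α)) ^ j *
        (Set.Ico ((2 : ℝ≥0∞) ^ (-(m + 1 - j : ℤ) - 1))
          ((2 : ℝ≥0∞) ^ (-(m + 1 - j : ℤ)))).indicator (fun t => t ^ α) (ρ (e i)) := by
    intro i
    by_cases hi : t ≤ |2 * (ρ (e i)).toReal|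
    swap
    · rw [Set.indicator_of_notMem (by exact hi), zero_mul]
      exact zero_le
    rw [Set.indicator_of_mem (by exact hi), one_mul]
    rw [abs_of_nonneg (by positivity)] at hi
    obtain ⟨k, hk⟩ := ENNReal.exists_mem_Ico_zpow (h0 i) (hρ (e i)) (y := 2) (by norm_num)
      (by norm_num)
    have hk2 : (2 : ℝ) ^ (-m - 1) < 2 * 2 ^ (k + 1) := by
      have : (ρ (e i)).toReal < 2 ^ (k + 1) := by
        rw [← ENNReal.ofReal_lt_ofReal_iff (by positivity), zpow_real_ennreal,
          ENNReal.ofReal_toReal (hρ _)]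
        exact hk.2
      linarith
    have hk3 : -m - 1 < k + 2 := by
      rw [← zpow_one_add₀ (by norm_num)] at hk2
      have := (zpow_lt_zpow_iff_right₀ (by norm_num : (1 : ℝ) < 2)).1 hk2
      omega
    obtain ⟨j, hj⟩ := Int.eq_ofNat_of_zero_le (a := m + 2 + k) (by omega)
    have e1 : -(m + 1 - (j : ℤ)) - 1 = k := by omega
    have e2 : -(m + 1 - (j : ℤ)) = k + 1 := by omega
    refine le_trans ?_ (mul_le_mul_right (ENNReal.le_tsum j) _)
    rw [e1, e2, Set.indicator_of_mem hk]
    have ht2 : ENNReal.ofReal t ≤ (2 : ℝ≥0∞) ^ (-m) := by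
      rw [← zpow_real_ennreal]
      exact ENNReal.ofReal_le_ofReal ht'.le
    calc ENNReal.ofReal t ^ α ≤ ((2 : ℝ≥0∞) ^ (-m)) ^ α := by gcongr
      _ = (2 : ℝ≥0∞) ^ (2 * α) * (((2 : ℝ≥0∞) ^ (-α)) ^ j * ((2 : ℝ≥0∞) ^ k) ^ α) := by
        rw [← ENNReal.rpow_natCast, ← ENNReal.rpow_intCast, ← ENNReal.rpow_intCast,
          ← ENNReal.rpow_mul, ← ENNReal.rpow_mul, ← ENNReal.rpow_mul,
          ← ENNReal.rpow_add _ _ (by norm_num) (by norm_num),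
          ← ENNReal.rpow_add _ _ (by norm_num) (by norm_num)]
        congr 1
        have : (j : ℝ) = m + 2 + k := by exact_mod_cast hj.symm
        rw [this]
        push_cast
        ring
      _ ≤ _ := by
        gcongr
        exact hk.1
  rw [distCount, ← ENNReal.tsum_mul_right]
  calc _ ≤ ∑' i : Fin n, (2 : ℝ≥0∞) ^ (2 * α) * ∑' j : ℕ, ((2 : ℝ≥0∞) ^ (-α)) ^ j *
        (Set.Ico ((2 : ℝ≥0∞) ^ (-(m + 1 - j : ℤ) - 1))
          ((2 : ℝ≥0∞) ^ (-(m + 1 - j : ℤ)))).indicator (fun t => t ^ α) (ρ (e i)) :=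
        ENNReal.tsum_le_tsum h1
    _ ≤ _ := by
      rw [ENNReal.tsum_mul_left, ENNReal.tsum_comm]
      gcongr with j
      rw [ENNReal.tsum_mul_left]
      gcongr
      exact ENNReal.tsum_comp_le_tsum_of_injective he (fun l =>
        (Set.Ico ((2 : ℝ≥0∞) ^ (-(m + 1 - j : ℤ) - 1))
          ((2 : ℝ≥0∞) ^ (-(m + 1 - j : ℤ)))).indicator (fun t => t ^ α) (ρ l))

/-- The Lorentz quasi-norm is controlled by the dyadic sum. -/
theorem lorentz_bound (α q : ℝ) (hα : 0 < α) (hq : 0 < q) :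
    ∃ K : ℝ≥0∞, K ≠ ⊤ ∧ ∀ (ρ : ℕ → ℝ≥0∞) (_ : ∀ j, ρ j ≠ ⊤) (n : ℕ)
      (e : Fin n → ℕ) (_ : Function.Injective e) (_ : ∀ i, ρ (e i) ≠ 0),
      (lorentzSeqNorm α q (fun i => 2 * (ρ (e i)).toReal)) ^ q ≤
        K * ∑' k : ℤ, (blk α ρ k) ^ (q / α) := by
  have hp : 0 < q / α := div_pos hq hα
  obtain ⟨K, hK, hK2⟩ := hardy_geom ((2 : ℝ≥0∞) ^ (-α))
    (ENNReal.rpow_lt_one_of_one_lt_of_neg (by norm_num) (by linarith)) (q / α) hp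
  refine ⟨ENNReal.ofReal q * ((2 : ℝ≥0∞) ^ (2 * α)) ^ (q / α) * K, ?_, ?_⟩
  · refine ENNReal.mul_ne_top (ENNReal.mul_ne_top (by simp) ?_) hK
    refine ENNReal.rpow_ne_top_of_nonneg hp.le (ENNReal.rpow_ne_top_of_nonneg (by positivity)
      (by norm_num))
  intro ρ hρ n e he h0
  rw [lorentzSeqNorm, ← ENNReal.rpow_mul, one_div, inv_mul_cancel₀ hq.ne', ENNReal.rpow_one,
    mul_assoc, mul_assoc]
  gcongr
  have hsub : Ioi (0 : ℝ) ⊆ ⋃ m : ℤ, Ico ((2 : ℝ) ^ (-m - 1)) ((2 : ℝ) ^ (-m)) := by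
    intro t ht
    obtain ⟨k, hk⟩ := exists_mem_Ico_zpow (x := t) (y := (2 : ℝ)) ht (by norm_num)
    refine mem_iUnion.2 ⟨-k - 1, ?_⟩
    have e1 : -(-k - 1) - 1 = k := by ring
    have e2 : -(-k - 1) = k + 1 := by ring
    rw [e1, e2]
    exact hk
  refine (lintegral_mono_set hsub).trans ((lintegral_iUnion_le _ _).trans ?_)
  calc _ ≤ ∑' m : ℤ, ((2 : ℝ≥0∞) ^ (2 * α) *
        ∑' j : ℕ, ((2 : ℝ≥0∞) ^ (-α)) ^ j * blk α ρ (m + 1 - j)) ^ (q / α) := by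
        refine ENNReal.tsum_le_tsum fun m => ?_
        set Y := ((2 : ℝ≥0∞) ^ (2 * α) *
          ∑' j : ℕ, ((2 : ℝ≥0∞) ^ (-α)) ^ j * blk α ρ (m + 1 - j)) ^ (q / α)
        calc _ ≤ ∫⁻ _ in Ico ((2 : ℝ) ^ (-m - 1)) ((2 : ℝ) ^ (-m)),
              Y * (ENNReal.ofReal ((2 : ℝ) ^ (-m - 1)))⁻¹ := by
              refine setLIntegral_mono' measurableSet_Ico fun t ht => ?_
              gcongr
              · exact ENNReal.rpow_le_rpow (dist_bound α hα ρ hρ n e he h0 m t ht.1 ht.2) hp.le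
              · exact ht.1
          _ = Y := by
              rw [setLIntegral_const, Real.volume_Ico]
              have : (2 : ℝ) ^ (-m) - 2 ^ (-m - 1) = 2 ^ (-m - 1) := by
                have : (2 : ℝ) ^ (-m) = 2 ^ (-m - 1) * 2 := by
                  rw [← zpow_add_one₀ (by norm_num)]
                  congr 1
                  ring
                rw [this]
                ring
              rw [this, mul_assoc, ENNReal.inv_mul_cancel, mul_one]
              · simp only [ne_eq, ENNReal.ofReal_eq_zero, not_le]
                positivity
              · simp
    _ ≤ _ := by
        simp_rw [ENNReal.mul_rpow_of_nonneg _ _ hp.le]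
        rw [ENNReal.tsum_mul_left]
        gcongr
        exact hK2 _

/-- A bounded set which is a down-set for the distance to `x` is a countable increasing union of
closed balls. -/
theorem downset_struct {d : ℕ} (x : Euc d) (S : Set (Euc d)) (hne : S.Nonempty) (ρ : ℝ)
    (hS : S ⊆ Metric.closedBall x ρ) (hdown : ∀ y ∈ S, ∀ z, dist z x ≤ dist y x → z ∈ S) :
    ∃ u : ℕ → ℝ, Monotone u ∧ (∀ n, 0 ≤ u n ∧ u n ≤ ρ) ∧
      S = ⋃ n, Metric.closedBall x (u n) := by
  set D := (fun y => dist y x) '' S with hD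
  have hDne : D.Nonempty := hne.image _
  have hDb : BddAbove D := ⟨ρ, by rintro _ ⟨y, hy, rfl⟩; exact hS hy⟩
  obtain ⟨u, hu, hut, huD⟩ := exists_seq_tendsto_sSup hDne hDb
  have hsub : ∀ t ∈ D, Metric.closedBall x t ⊆ S := by
    rintro _ ⟨y, hy, rfl⟩ z hz
    exact hdown y hy z hz
  have hbd : ∀ t ∈ D, 0 ≤ t ∧ t ≤ ρ := by
    rintro _ ⟨y, hy, rfl⟩
    exact ⟨dist_nonneg, hS hy⟩
  by_cases hmem : sSup D ∈ D
  · refine ⟨fun _ => sSup D, monotone_const, fun _ => hbd _ hmem, ?_⟩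
    rw [iUnion_const]
    refine Subset.antisymm (fun y hy => ?_) (hsub _ hmem)
    exact le_csSup hDb ⟨y, hy, rfl⟩
  · refine ⟨u, hu, fun n => hbd _ (huD n), ?_⟩
    refine Subset.antisymm (fun y hy => ?_) (iUnion_subset fun n => hsub _ (huD n))
    have h1 : dist y x < sSup D := by
      refine lt_of_le_of_ne (le_csSup hDb ⟨y, hy, rfl⟩) fun h => hmem ?_
      rw [← h]
      exact ⟨y, hy, rfl⟩
    obtain ⟨n, hn⟩ := (hut.eventually (lt_mem_nhds h1)).exists
    exact mem_iUnion.2 ⟨n, hn.le⟩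

theorem downset_meas {d : ℕ} (x : Euc d) (S : Set (Euc d)) (ρ : ℝ)
    (hS : S ⊆ Metric.closedBall x ρ) (hdown : ∀ y ∈ S, ∀ z, dist z x ≤ dist y x → z ∈ S) :
    MeasurableSet S := by
  rcases S.eq_empty_or_nonempty with rfl | hne
  · exact MeasurableSet.empty
  obtain ⟨u, -, -, h⟩ := downset_struct x S hne ρ hS hdown
  rw [h]
  exact MeasurableSet.iUnion fun n => measurableSet_closedBall

theorem downset_le {d : ℕ} (μ ν : Measure (Euc d)) (x : Euc d) (S : Set (Euc d)) (ρ : ℝ)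
    (hS : S ⊆ Metric.closedBall x ρ) (hdown : ∀ y ∈ S, ∀ z, dist z x ≤ dist y x → z ∈ S)
    (h : ∀ r, 0 ≤ r → r ≤ ρ → ν (Metric.closedBall x r) ≤ 2⁻¹ * μ (Metric.closedBall x r)) :
    ν S ≤ 2⁻¹ * μ S := by
  rcases S.eq_empty_or_nonempty with rfl | hne
  · simp
  obtain ⟨u, hu, hu2, hSu⟩ := downset_struct x S hne ρ hS hdown
  rw [hSu, Monotone.measure_iUnion (fun a b hab => Metric.closedBall_subset_closedBall (hu hab))]
  refine iSup_le fun n => (h _ (hu2 n).1 (hu2 n).2).trans ?_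
  gcongr
  exact subset_iUnion (fun n => Metric.closedBall x (u n)) n

/-- Basic facts on the radial profile. -/
theorem phi_lower {d : ℕ} (φ : Euc d → ℝ) (hpos : ∀ y, 0 ≤ φ y)
    (hmono : ∀ y z : Euc d, ‖y‖ ≤ ‖z‖ → φ z ≤ φ y)
    (hsupp : closure (Function.support φ) = Metric.closedBall 0 3) :
    ∃ c : ℝ, 0 < c ∧ ∀ y, ‖y‖ ≤ 14 / 5 → c ≤ φ y := by
  by_cases hz : ∃ z, φ z ≠ 0 ∧ 14 / 5 ≤ ‖z‖
  · obtain ⟨z, hz, hz2⟩ := hz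
    exact ⟨φ z, lt_of_le_of_ne (hpos z) hz.symm, fun y hy => hmono _ _ (hy.trans hz2)⟩
  push Not at hz
  have h1 : Function.support φ ⊆ Metric.closedBall 0 (14 / 5) := by
    intro z hz'
    simpa using (hz z hz').le
  have h2 : Metric.closedBall (0 : Euc d) 3 ⊆ Metric.closedBall 0 (14 / 5) := by
    rw [← hsupp]
    exact closure_minimal h1 Metric.isClosed_closedBall
  have h3 : ∀ y : Euc d, y = 0 := by
    intro y
    by_contra hy
    have hy' : 0 < ‖y‖ := norm_pos_iff.2 hy
    have hn : ‖(3 / ‖y‖) • y‖ = 3 := by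
      rw [norm_smul, Real.norm_of_nonneg (by positivity)]
      field_simp
    have := h2 (show (3 / ‖y‖) • y ∈ Metric.closedBall (0 : Euc d) 3 by simp [hn])
    rw [mem_closedBall_zero_iff, hn] at this
    norm_num at this
  refine ⟨φ 0, lt_of_le_of_ne (hpos 0) fun h => ?_, fun y _ => by rw [h3 y]⟩
  have h4 : Function.support φ = ∅ := by
    ext y
    simp [h3 y, ← h]
  rw [h4, closure_empty] at hsupp
  have : (0 : Euc d) ∈ (∅ : Set (Euc d)) := by
    rw [hsupp]
    simp
  exact this

theorem phi_level {d : ℕ} (φ : Euc d → ℝ)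
    (hmono : ∀ y z : Euc d, ‖y‖ ≤ ‖z‖ → φ z ≤ φ y)
    (hsupp : closure (Function.support φ) = Metric.closedBall 0 3)
    (x : Euc d) (R : ℝ) (hR : 0 < R) (t : ℝ) (ht : 0 < t) :
    {y | t ≤ φ (R⁻¹ • (y - x))} ⊆ Metric.closedBall x (3 * R) ∧
    ∀ y ∈ {y | t ≤ φ (R⁻¹ • (y - x))}, ∀ z, dist z x ≤ dist y x →
      z ∈ {y | t ≤ φ (R⁻¹ • (y - x))} := by
  have hn : ∀ y : Euc d, ‖R⁻¹ • (y - x)‖ = R⁻¹ * dist y x := by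
    intro y
    rw [norm_smul, Real.norm_of_nonneg (by positivity), dist_eq_norm]
  constructor
  · intro y hy
    have h1 : R⁻¹ • (y - x) ∈ closure (Function.support φ) :=
      subset_closure (ne_of_gt (lt_of_lt_of_le ht hy))
    rw [hsupp, mem_closedBall_zero_iff, hn, inv_mul_le_iff₀ hR] at h1
    rw [Metric.mem_closedBall]
    linarith
  · intro y hy z hz
    refine le_trans (show t ≤ φ (R⁻¹ • (y - x)) from hy) (hmono _ _ ?_)
    rw [hn, hn]
    gcongr

theorem phi_meas {d : ℕ} (φ : Euc d → ℝ) (hpos : ∀ y, 0 ≤ φ y)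
    (hmono : ∀ y z : Euc d, ‖y‖ ≤ ‖z‖ → φ z ≤ φ y)
    (hsupp : closure (Function.support φ) = Metric.closedBall 0 3)
    (x : Euc d) (R : ℝ) (hR : 0 < R) : Measurable (fun y => φ (R⁻¹ • (y - x))) := by
  refine measurable_of_Ici fun t => ?_
  rcases le_or_gt t 0 with ht | ht
  · convert MeasurableSet.univ
    ext y
    simpa using ht.trans (hpos _)
  · obtain ⟨h1, h2⟩ := phi_level φ hmono hsupp x R hR t ht
    exact downset_meas x _ _ h1 h2

theorem phi_compare {d : ℕ} (φ : Euc d → ℝ) (hbdd : ∃ M : ℝ, ∀ y, |φ y| ≤ M)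
    (hpos : ∀ y, 0 ≤ φ y)
    (hmono : ∀ y z : Euc d, ‖y‖ ≤ ‖z‖ → φ z ≤ φ y)
    (hsupp : closure (Function.support φ) = Metric.closedBall 0 3)
    (c : ℝ) (hc0 : 0 < c) (hc : ∀ y, ‖y‖ ≤ 14 / 5 → c ≤ φ y)
    (μ ν : Measure (Euc d)) [IsFiniteMeasure μ] [IsFiniteMeasure ν]
    (x : Euc d) (R : ℝ) (hR : 0 < R)
    (h : ∀ r, 0 ≤ r → r ≤ 3 * R →
      ν (Metric.closedBall x r) ≤ 2⁻¹ * μ (Metric.closedBall x r)) :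
    c / 2 * μ.real (Metric.closedBall x (14 / 5 * R)) ≤
      (∫ y, φ (R⁻¹ • (y - x)) ∂μ) - ∫ y, φ (R⁻¹ • (y - x)) ∂ν := by
  obtain ⟨M, hM⟩ := hbdd
  have hm := phi_meas φ hpos hmono hsupp x R hR
  have hintegr : ∀ (κ : Measure (Euc d)) [IsFiniteMeasure κ],
      Integrable (fun y => φ (R⁻¹ • (y - x))) κ := fun κ _ =>
    Integrable.of_bound hm.aestronglyMeasurable M (Filter.Eventually.of_forall fun y => hM _)
  have h1 : ∫⁻ y, ENNReal.ofReal (φ (R⁻¹ • (y - x))) ∂ν ≤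
      2⁻¹ * ∫⁻ y, ENNReal.ofReal (φ (R⁻¹ • (y - x))) ∂μ := by
    rw [lintegral_eq_lintegral_meas_le ν (Filter.Eventually.of_forall fun y => hpos _)
      hm.aemeasurable,
      lintegral_eq_lintegral_meas_le μ (Filter.Eventually.of_forall fun y => hpos _)
      hm.aemeasurable, ← lintegral_const_mul' _ _ (by simp)]
    refine setLIntegral_mono' measurableSet_Ioi fun t ht => ?_
    obtain ⟨h1, h2⟩ := phi_level φ hmono hsupp x R hR t ht
    exact downset_le μ ν x _ _ h1 h2 h
  have h2 : ∫ y, φ (R⁻¹ • (y - x)) ∂ν ≤ 2⁻¹ * ∫ y, φ (R⁻¹ • (y - x)) ∂μ := by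
    rw [← ofReal_integral_eq_lintegral_ofReal (hintegr ν)
      (Filter.Eventually.of_forall fun y => hpos _),
      ← ofReal_integral_eq_lintegral_ofReal (hintegr μ)
      (Filter.Eventually.of_forall fun y => hpos _)] at h1
    have h3 : (2⁻¹ : ℝ≥0∞) = ENNReal.ofReal 2⁻¹ := by
      rw [ENNReal.ofReal_inv_of_pos (by norm_num)]
      norm_num
    have h0 : 0 ≤ ∫ y, φ (R⁻¹ • (y - x)) ∂μ := integral_nonneg fun y => hpos _
    rwa [h3, ← ENNReal.ofReal_mul (by norm_num), ENNReal.ofReal_le_ofReal_iff (by positivity)]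
      at h1
  have h3 : c * μ.real (Metric.closedBall x (14 / 5 * R)) ≤ ∫ y, φ (R⁻¹ • (y - x)) ∂μ := by
    have : ∫ y, (Metric.closedBall x (14 / 5 * R)).indicator (fun _ => c) y ∂μ
        = c * μ.real (Metric.closedBall x (14 / 5 * R)) := by
      rw [integral_indicator measurableSet_closedBall, setIntegral_const, smul_eq_mul, mul_comm]
    rw [← this]
    refine integral_mono ((integrable_const c).indicator measurableSet_closedBall) (hintegr μ)
      (Set.indicator_le' (fun y hy => ?_) (fun y _ => hpos _))
    apply hc
    rw [norm_smul, Real.norm_of_nonneg (by positivity), ← dist_eq_norm, inv_mul_le_iff₀ hR]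
    rw [Metric.mem_closedBall] at hy
    linarith
  linarith

/-- Points where `ν` is dominated by `μ / 2` on all small closed balls. -/
def goodSet {d : ℕ} (μ ν : Measure (Euc d)) (N : ℕ) : Set (Euc d) :=
  {x | ∀ r : ℝ, 0 ≤ r → r ≤ 1 / ((N : ℝ) + 1) →
    ν (Metric.closedBall x r) ≤ 2⁻¹ * μ (Metric.closedBall x r)}

theorem goodSet_mono {d : ℕ} (μ ν : Measure (Euc d)) : Monotone (goodSet μ ν) := by
  intro a b hab x hx r h0 hr
  refine hx r h0 (hr.trans ?_)
  gcongr

theorem goodSet_ae {d : ℕ} (μ ν : Measure (Euc d)) [IsFiniteMeasure μ] [IsFiniteMeasure ν]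
    (hs : μ ⟂ₘ ν) : ∀ᵐ x ∂μ, x ∈ ⋃ N, goodSet μ ν N := by
  have h1 := Besicovitch.ae_tendsto_rnDeriv ν μ
  have h2 := hs.symm.rnDeriv_ae_eq_zero
  obtain ⟨S, -, hS1, hS2⟩ := hs
  have h3 : ∀ᵐ x ∂μ, x ∈ Sᶜ := by
    rw [ae_iff]
    simpa using hS1
  filter_upwards [h1, h2, h3] with x h1 h2 h3
  rw [h2] at h1
  have h4 := h1.eventually (gt_mem_nhds (show (0 : ℝ≥0∞) < 2⁻¹ by simp))
  rw [Filter.eventually_iff, mem_nhdsGT_iff_exists_Ioo_subset] at h4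
  obtain ⟨ε, hε, h4⟩ := h4
  obtain ⟨N, hN⟩ := exists_nat_one_div_lt (show (0 : ℝ) < ε from hε)
  refine mem_iUnion.2 ⟨N, fun r h0 hr => ?_⟩
  rcases h0.eq_or_lt with rfl | h0
  · rw [Metric.closedBall_zero, measure_mono_null (singleton_subset_iff.2 h3) hS2]
    exact zero_le
  · have h5 : ν (Metric.closedBall x r) / μ (Metric.closedBall x r) < 2⁻¹ :=
      h4 ⟨h0, hr.trans_lt hN⟩
    have h6 : μ (Metric.closedBall x r) ≠ 0 ∨ ν (Metric.closedBall x r) = 0 := by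
      by_contra hcon
      push Not at hcon
      rw [hcon.1, ENNReal.div_zero hcon.2] at h5
      exact not_top_lt h5
    rcases h6 with h6 | h6
    · exact (ENNReal.div_le_iff h6 (measure_ne_top _ _)).1 h5.le
    · rw [h6]
      exact zero_le

section core

theorem packing_s16 {d : ℕ} (α q γ : ℝ)
    (φ : Euc d → ℝ) (hbdd : ∃ M : ℝ, ∀ y, |φ y| ≤ M)
    (hpos : ∀ y, 0 ≤ φ y)
    (hmono : ∀ y z : Euc d, ‖y‖ ≤ ‖z‖ → φ z ≤ φ y)
    (hsupp : closure (Function.support φ) = Metric.closedBall 0 3)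
    (c : ℝ) (hc0 : 0 < c) (hc : ∀ y, ‖y‖ ≤ 14 / 5 → c ≤ φ y)
    (μ ν : Measure (Euc d)) [IsFiniteMeasure μ] [IsFiniteMeasure ν] (C : ℝ)
    (H : ∀ (n : ℕ) (x : Fin n → Euc d) (r : Fin n → ℝ),
      (∀ i, 0 < r i) → (∀ i, r i < 1) →
      (Pairwise fun i j => Disjoint (Metric.ball (x i) (r i)) (Metric.ball (x j) (r j))) →
      ENNReal.ofReal |∑ i : Fin n, ((∫ y, φ ((r i)⁻¹ • (y - x i)) ∂μ) -
          ∫ y, φ ((r i)⁻¹ • (y - x i)) ∂ν)|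
        ≤ ENNReal.ofReal C * ((lorentzSeqNorm α q r) ^ q) ^ γ)
    (N n : ℕ) (x : Fin n → Euc d) (r : Fin n → ℝ) (hx : ∀ i, x i ∈ goodSet μ ν N)
    (hr0 : ∀ i, 0 < r i) (hrN : ∀ i, 3 * r i ≤ 1 / ((N : ℝ) + 1))
    (hdis : Pairwise fun i j =>
      Disjoint (Metric.ball (x i) (r i)) (Metric.ball (x j) (r j))) :
    ENNReal.ofReal (c / 2) * μ (⋃ i, Metric.closedBall (x i) (14 / 5 * r i)) ≤
      ENNReal.ofReal C * ((lorentzSeqNorm α q r) ^ q) ^ γ := by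
  have hr1 : ∀ i, r i < 1 := by
    intro i
    have h1 : 1 / ((N : ℝ) + 1) ≤ 1 := by
      rw [div_le_one (by positivity)]
      linarith [(Nat.cast_nonneg N : (0 : ℝ) ≤ N)]
    linarith [hrN i]
  refine le_trans ?_ (H n x r hr0 hr1 hdis)
  have h1 : ∀ i, c / 2 * μ.real (Metric.closedBall (x i) (14 / 5 * r i)) ≤
      (∫ y, φ ((r i)⁻¹ • (y - x i)) ∂μ) - ∫ y, φ ((r i)⁻¹ • (y - x i)) ∂ν := fun i =>
    phi_compare φ hbdd hpos hmono hsupp c hc0 hc μ ν (x i) (r i) (hr0 i)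
      fun s h0 hs => hx i s h0 (hs.trans (hrN i))
  calc _ ≤ ENNReal.ofReal (c / 2) * ∑ i, μ (Metric.closedBall (x i) (14 / 5 * r i)) := by
        gcongr
        exact measure_iUnion_fintype_le μ _
    _ = ENNReal.ofReal (∑ i, c / 2 * μ.real (Metric.closedBall (x i) (14 / 5 * r i))) := by
        rw [← Finset.mul_sum, ENNReal.ofReal_mul (by positivity),
          ENNReal.ofReal_sum_of_nonneg (fun i _ => measureReal_nonneg)]
        congr 1
        refine Finset.sum_congr rfl fun i _ => ?_
        rw [ofReal_measureReal]
    _ ≤ _ := by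
        apply ENNReal.ofReal_le_ofReal
        exact (Finset.sum_le_sum fun i _ => h1 i).trans (le_abs_self _)

theorem blk_single (α q : ℝ) (hα : 0 < α) (hq : 0 < q) (m : ℕ) :
    ∑' k : ℤ, (blk α (fun j => if j = 0 then (2 : ℝ≥0∞) ^ (-(m : ℤ) - 1) else 0) k) ^ (q / α) =
      ((2 : ℝ≥0∞) ^ (-(m : ℤ) - 1)) ^ q := by
  have hp : 0 < q / α := div_pos hq hα
  have hblk : ∀ k : ℤ, blk α (fun j => if j = 0 then (2 : ℝ≥0∞) ^ (-(m : ℤ) - 1) else 0) k =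
      (Set.Ico ((2 : ℝ≥0∞) ^ (-k - 1)) ((2 : ℝ≥0∞) ^ (-k))).indicator
        (fun t => t ^ α) ((2 : ℝ≥0∞) ^ (-(m : ℤ) - 1)) := by
    intro k
    rw [blk, tsum_eq_single 0]
    · simp
    · intro j hj
      simp only [hj, if_false]
      by_cases h : (0 : ℝ≥0∞) ∈ Set.Ico ((2 : ℝ≥0∞) ^ (-k - 1)) ((2 : ℝ≥0∞) ^ (-k))
      · rw [Set.indicator_of_mem h, ENNReal.zero_rpow_of_pos hα]
      · rw [Set.indicator_of_notMem h]
  have hlt : ∀ a b : ℤ, (2 : ℝ≥0∞) ^ a < 2 ^ b → a < b := by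
    intro a b hab
    by_contra hcon
    push Not at hcon
    exact absurd (ENNReal.zpow_le_of_le (by norm_num) hcon) (not_le.2 hab)
  simp_rw [hblk]
  rw [tsum_eq_single (m : ℤ)]
  · rw [Set.indicator_of_mem, ← ENNReal.rpow_mul, mul_div_cancel₀ _ hα.ne']
    refine ⟨le_rfl, ?_⟩
    rw [← zpow_real_ennreal, ← zpow_real_ennreal, ENNReal.ofReal_lt_ofReal_iff (by positivity)]
    exact zpow_lt_zpow_right₀ (by norm_num) (by omega)
  · intro k hk
    rw [Set.indicator_of_notMem, ENNReal.zero_rpow_of_pos hp]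
    rintro ⟨h1, h2⟩
    have h3 := hlt _ _ h2
    have h4 : ¬ (-(m : ℤ) - 1 < -k - 1) := fun h => by
      rw [← zpow_real_ennreal, ← zpow_real_ennreal, ENNReal.ofReal_le_ofReal_iff (by positivity)]
        at h1
      exact absurd (zpow_lt_zpow_right₀ (by norm_num : (1 : ℝ) < 2) h) (not_lt.2 h1)
    omega

theorem core {d : ℕ} (α q γ : ℝ) (hα : 0 < α) (hq : 0 < q) (hγ : 0 < γ)
    (φ : Euc d → ℝ) (hbdd : ∃ M : ℝ, ∀ y, |φ y| ≤ M)
    (hpos : ∀ y, 0 ≤ φ y)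
    (hmono : ∀ y z : Euc d, ‖y‖ ≤ ‖z‖ → φ z ≤ φ y)
    (hsupp : closure (Function.support φ) = Metric.closedBall 0 3)
    (μ ν : Measure (Euc d)) [IsFiniteMeasure μ] [IsFiniteMeasure ν] (hs : μ ⟂ₘ ν) (C : ℝ)
    (H : ∀ (n : ℕ) (x : Fin n → Euc d) (r : Fin n → ℝ),
      (∀ i, 0 < r i) → (∀ i, r i < 1) →
      (Pairwise fun i j => Disjoint (Metric.ball (x i) (r i)) (Metric.ball (x j) (r j))) →
      ENNReal.ofReal |∑ i : Fin n, ((∫ y, φ ((r i)⁻¹ • (y - x i)) ∂μ) -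
          ∫ y, φ ((r i)⁻¹ • (y - x i)) ∂ν)|
        ≤ ENNReal.ofReal C * ((lorentzSeqNorm α q r) ^ q) ^ γ) :
    ∃ K : ℝ≥0∞, K ≠ ⊤ ∧ ∀ A : Set (Euc d), μ A ≤ K * (NHfin d α (q / α) A) ^ γ := by
  obtain ⟨c, hc0, hc⟩ := phi_lower φ hpos hmono hsupp
  obtain ⟨K0, hK0, hlor⟩ := lorentz_bound α q hα hq
  have hpack := packing_s16 α q γ φ hbdd hpos hmono hsupp c hc0 hc μ ν C H
  have hc2 : ENNReal.ofReal (c / 2) ≠ 0 := by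
    simp only [ne_eq, ENNReal.ofReal_eq_zero, not_le]
    positivity
  -- atoms
  have hatom : ∀ N, ∀ x ∈ goodSet μ ν N, μ {x} = 0 := by
    intro N x hx
    have hev : ∀ᶠ m : ℕ in Filter.atTop, ENNReal.ofReal (c / 2) * μ {x} ≤
        ENNReal.ofReal C * (K0 * ((2 : ℝ≥0∞) ^ (-(m : ℤ) - 1)) ^ q) ^ γ := by
      have hlim : Filter.Tendsto (fun m : ℕ => 3 * ((1 : ℝ) / 2) ^ m) Filter.atTop (nhds 0) := by
        simpa using (_root_.tendsto_pow_atTop_nhds_zero_of_lt_one (r := (1 : ℝ) / 2) (by norm_num)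
          (by norm_num)).const_mul 3
      filter_upwards [hlim.eventually
        (gt_mem_nhds (show (0 : ℝ) < 1 / ((N : ℝ) + 1) by positivity))] with m hm
      have hval : 2 * ((2 : ℝ≥0∞) ^ (-(m : ℤ) - 1)).toReal = (1 / 2 : ℝ) ^ m := by
        rw [← zpow_real_ennreal, ENNReal.toReal_ofReal (by positivity),
          ← zpow_one_add₀ (by norm_num)]
        have : 1 + (-(m : ℤ) - 1) = -(m : ℤ) := by ring
        rw [this, zpow_neg, zpow_natCast]
        simp
      have h1 := hlor (fun j => if j = 0 then (2 : ℝ≥0∞) ^ (-(m : ℤ) - 1) else 0)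
        (by
          intro j
          by_cases hj : j = 0
          · simp only [hj, if_true]
            rw [← zpow_real_ennreal]
            simp
          · simp [hj])
        1 (fun _ => 0) (fun a b _ => Subsingleton.elim a b)
        (by
          intro i
          simp only [if_true]
          rw [← zpow_real_ennreal]
          simp only [ne_eq, ENNReal.ofReal_eq_zero, not_le]
          positivity)
      rw [blk_single α q hα hq m] at h1
      simp only [if_true] at h1
      have h2 := hpack N 1 (fun _ => x) (fun _ => 2 * ((2 : ℝ≥0∞) ^ (-(m : ℤ) - 1)).toReal)
        (fun _ => hx) (fun _ => by rw [hval]; positivity) (fun _ => by rw [hval]; exact hm.le)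
        (fun i j hij => absurd (Subsingleton.elim i j) hij)
      refine le_trans ?_ (h2.trans ?_)
      · gcongr
        refine singleton_subset_iff.2 (mem_iUnion.2 ⟨0, Metric.mem_closedBall_self ?_⟩)
        rw [hval]
        positivity
      · gcongr
    have hlim : Filter.Tendsto (fun m : ℕ =>
        ENNReal.ofReal C * (K0 * ((2 : ℝ≥0∞) ^ (-(m : ℤ) - 1)) ^ q) ^ γ) Filter.atTop
        (nhds (ENNReal.ofReal C * (K0 * (0 : ℝ≥0∞) ^ q) ^ γ)) := by
      refine ENNReal.Tendsto.const_mul ?_ (Or.inr (by simp))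
      refine Filter.Tendsto.ennrpow_const γ ?_
      refine ENNReal.Tendsto.const_mul ?_ (Or.inr hK0)
      refine Filter.Tendsto.ennrpow_const q ?_
      have : (fun m : ℕ => (2 : ℝ≥0∞) ^ (-(m : ℤ) - 1)) = fun m : ℕ => (2⁻¹ : ℝ≥0∞) ^ (m + 1) := by
        funext m
        rw [← ENNReal.inv_pow, ← zpow_natCast, ← ENNReal.zpow_neg]
        congr 1
        push_cast
        ring
      rw [this]
      exact (ENNReal.tendsto_pow_atTop_nhds_zero_of_lt_one (by simp)).comp
        (Filter.tendsto_add_atTop_nat 1)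
    have := ge_of_tendsto hlim hev
    rw [ENNReal.zero_rpow_of_pos hq, mul_zero, ENNReal.zero_rpow_of_pos hγ, mul_zero] at this
    rcases mul_eq_zero.1 (le_antisymm this zero_le) with h | h
    · exact absurd h hc2
    · exact h
  -- coverings
  have hcov : ∀ (N : ℕ) (A : Set (Euc d)) (B : ℕ → Set (Euc d)), A ⊆ ⋃ j, B j →
      (∀ j, EMetric.diam (B j) < ENNReal.ofReal (1 / (6 * ((N : ℝ) + 1)))) →
      ENNReal.ofReal (c / 2) * μ (A ∩ goodSet μ ν N) ≤
        ENNReal.ofReal C * (K0 * ∑' k : ℤ, (dyadicBlock α B k) ^ (q / α)) ^ γ := by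
    intro N A B hA hB
    have hBt : ∀ j, EMetric.diam (B j) ≠ ⊤ := fun j => (hB j).ne_top
    set R : ℕ → ℝ := fun j => 2 * (EMetric.diam (B j)).toReal with hR
    have hRN : ∀ j, 3 * R j ≤ 1 / ((N : ℝ) + 1) := by
      intro j
      have h1 : (EMetric.diam (B j)).toReal ≤ 1 / (6 * ((N : ℝ) + 1)) :=
        ENNReal.toReal_le_of_le_ofReal (by positivity) (hB j).le
      have h2 : 1 / ((N : ℝ) + 1) = 6 * (1 / (6 * ((N : ℝ) + 1))) := by
        field_simp
      rw [h2]
      simp only [hR]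
      linarith
    have hunion : A ∩ goodSet μ ν N = ⋃ M : ℕ, (A ∩ goodSet μ ν N) ∩ ⋃ j ∈ Set.Iio M, B j := by
      ext y
      simp only [mem_iUnion, mem_inter_iff]
      constructor
      · intro hy
        obtain ⟨j, hj⟩ := mem_iUnion.1 (hA hy.1)
        exact ⟨j + 1, hy, j, Nat.lt_succ_self j, hj⟩
      · rintro ⟨M, hy, -⟩
        exact hy
    have hmonoM : Monotone fun M : ℕ => (A ∩ goodSet μ ν N) ∩ ⋃ j ∈ Set.Iio M, B j := by
      intro a b hab
      refine inter_subset_inter_right _ (biUnion_subset_biUnion_left ?_)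
      exact Iio_subset_Iio hab
    rw [hunion, hmonoM.measure_iUnion, ENNReal.mul_iSup]
    refine iSup_le fun M => ?_
    set t : Set ℕ := {j | j < M ∧ EMetric.diam (B j) ≠ 0 ∧ (goodSet μ ν N ∩ B j).Nonempty} with ht
    have htf : t.Finite := (Set.finite_Iio M).subset fun j hj => hj.1
    have hy : ∀ j, ∃ y : Euc d, j ∈ t → y ∈ goodSet μ ν N ∩ B j := by
      intro j
      by_cases hj : j ∈ t
      · obtain ⟨y, hy⟩ := hj.2.2
        exact ⟨y, fun _ => hy⟩
      · exact ⟨0, fun h => absurd h hj⟩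
    choose y hy using hy
    have hRpos : ∀ j ∈ t, 0 < R j := fun j hj => by
      have := ENNReal.toReal_pos hj.2.1 (hBt j)
      simp only [hR]
      positivity
    obtain ⟨u, hut, hudis, hucov⟩ := Vitali.exists_disjoint_subfamily_covering_enlargement
      (fun j => Metric.ball (y j) (R j)) t R (6 / 5) (by norm_num) (fun j hj => (hRpos j hj).le)
      (1 / ((N : ℝ) + 1)) (fun j hj => by linarith [hRN j, hRpos j hj])
      (fun j hj => ⟨y j, Metric.mem_ball_self (hRpos j hj)⟩)
    have huf : u.Finite := htf.subset hut
    set F := huf.toFinset with hF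
    set e : Fin F.card → ℕ := fun i => (F.equivFin.symm i : ℕ) with he
    have heinj : Function.Injective e :=
      Subtype.val_injective.comp F.equivFin.symm.injective
    have heu : ∀ i, e i ∈ u := fun i => huf.mem_toFinset.1 (F.equivFin.symm i).2
    have hsurj : ∀ j ∈ u, ∃ i, e i = j := by
      intro j hj
      refine ⟨F.equivFin ⟨j, by rwa [hF, Set.Finite.mem_toFinset]⟩, ?_⟩
      simp [he]
    have h1 := hpack N F.card (fun i => y (e i)) (fun i => R (e i))
      (fun i => (hy _ (hut (heu i))).1) (fun i => hRpos _ (hut (heu i))) (fun i => hRN _)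
      (fun i j hij => hudis (heu i) (heu j) fun h => hij (heinj h))
    have h2 := hlor (fun j => EMetric.diam (B j)) hBt F.card e heinj
      (fun i => (hut (heu i)).2.1)
    refine le_trans ?_ (h1.trans ?_)
    swap
    · gcongr
      exact h2
    gcongr 1
    have hnull : μ (⋃ j ∈ {j | EMetric.diam (B j) = 0}, goodSet μ ν N ∩ B j) = 0 := by
      rw [measure_biUnion_null_iff (Set.to_countable _)]
      intro j hj
      have hsub : (goodSet μ ν N ∩ B j).Subsingleton :=
        (Metric.ediam_eq_zero_iff.1 hj).anti inter_subset_right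
      rcases hsub.eq_empty_or_singleton with h | ⟨z, hz⟩
      · rw [h, measure_empty]
      · rw [hz]
        refine hatom N z ?_
        have : z ∈ goodSet μ ν N ∩ B j := by rw [hz]; rfl
        exact this.1
    have hsubset : (A ∩ goodSet μ ν N) ∩ ⋃ j ∈ Set.Iio M, B j ⊆
        (⋃ j ∈ {j | EMetric.diam (B j) = 0}, goodSet μ ν N ∩ B j) ∪
          ⋃ i, Metric.closedBall (y (e i)) (14 / 5 * R (e i)) := by
      rintro z ⟨⟨-, hzg⟩, hz⟩
      simp only [mem_iUnion] at hz
      obtain ⟨j, hjM, hzj⟩ := hz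
      by_cases hd : EMetric.diam (B j) = 0
      · left
        simp only [mem_iUnion]
        exact ⟨j, hd, hzg, hzj⟩
      right
      have hjt : j ∈ t := ⟨hjM, hd, z, hzg, hzj⟩
      obtain ⟨b, hbu, ⟨w, hw1, hw2⟩, hle⟩ := hucov j hjt
      obtain ⟨i, rfl⟩ := hsurj b hbu
      refine mem_iUnion.2 ⟨i, ?_⟩
      rw [Metric.mem_closedBall]
      have hd1 : dist z (y j) ≤ R j / 2 := by
        have : edist z (y j) ≤ EMetric.diam (B j) :=
          Metric.edist_le_ediam_of_mem hzj (hy j hjt).2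
        rw [dist_edist]
        simp only [hR]
        have := ENNReal.toReal_mono (hBt j) this
        linarith
      rw [Metric.mem_ball] at hw1 hw2
      have h3 := dist_triangle z (y j) (y (e i))
      have h4 := dist_triangle_left (y j) (y (e i)) w
      linarith
    calc _ ≤ _ := measure_mono hsubset
      _ ≤ _ := measure_union_le _ _
      _ = _ := by rw [hnull, zero_add]
  -- conclusion
  set K : ℝ≥0∞ := (ENNReal.ofReal (c / 2))⁻¹ * (ENNReal.ofReal C * K0 ^ γ) + 1 with hK
  have hKtop : K ≠ ⊤ := by
    refine ENNReal.add_ne_top.2 ⟨ENNReal.mul_ne_top (ENNReal.inv_ne_top.2 hc2)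
      (ENNReal.mul_ne_top (by simp) (ENNReal.rpow_ne_top_of_nonneg hγ.le hK0)), by simp⟩
  have hKz : K ≠ 0 := by simp [hK]
  refine ⟨K, hKtop, fun A => ?_⟩
  have hN : ∀ N, μ (A ∩ goodSet μ ν N) ≤ K * (NHfin d α (q / α) A) ^ γ := by
    intro N
    have h1 : (μ (A ∩ goodSet μ ν N) / K) ^ (γ⁻¹) ≤ NHfin d α (q / α) A := by
      refine le_trans ?_ (le_iSup₂ (ENNReal.ofReal (1 / (6 * ((N : ℝ) + 1))))
        (ENNReal.ofReal_pos.2 (by positivity)))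
      refine le_iInf fun B => le_iInf fun hA => le_iInf fun hB => ?_
      have h2 := hcov N A B hA hB
      rw [ENNReal.rpow_inv_le_iff hγ]
      refine ENNReal.div_le_of_le_mul' ?_
      rw [ENNReal.mul_rpow_of_nonneg _ _ hγ.le, ← mul_assoc] at h2
      have h3 := mul_le_mul_right h2 (ENNReal.ofReal (c / 2))⁻¹
      rw [← mul_assoc, ENNReal.inv_mul_cancel hc2 (by simp), one_mul, ← mul_assoc] at h3
      refine h3.trans ?_
      gcongr
      exact le_self_add
    rw [ENNReal.rpow_inv_le_iff hγ, ENNReal.div_le_iff hKz hKtop] at h1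
    rwa [mul_comm]
  have hA : μ A = μ (A ∩ ⋃ N, goodSet μ ν N) := by
    refine measure_congr ?_
    filter_upwards [goodSet_ae μ ν hs] with x hx
    exact propext ⟨fun h => ⟨h, hx⟩, fun h => h.1⟩
  rw [hA, inter_iUnion, Monotone.measure_iUnion
    (fun a b hab => inter_subset_inter_right _ (goodSet_mono μ ν hab))]
  exact iSup_le hN

end core

/-- Frostman-type lemma for Netrusov--Hausdorff capacities: if `φ` is a bounded radially
symmetric, radially non-increasing function with support exactly `closedBall 0 3`, `μ` a
signed measure of bounded variation with
`|∑_j ∫ φ((y-x_j)/r_j) dμ(y)| ≲ (‖{r_j}‖_{ℓ_{α,q}}^q)^γ` for every finite disjoint family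
of balls of radii `< 1`, then `|μ|(A) ≲ 𝓗_{α,q/α}(A)^γ` for every Borel `A`. -/
theorem stmt16 (d : ℕ) (α q γ : ℝ) (hα : 0 < α) (hq : 0 < q) (hγ : 0 < γ)
    (φ : Euc d → ℝ) (hbdd : ∃ M : ℝ, ∀ y, |φ y| ≤ M)
    (hpos : ∀ y, 0 ≤ φ y)
    (hrad : ∀ y z : Euc d, ‖y‖ = ‖z‖ → φ y = φ z)
    (hmono : ∀ y z : Euc d, ‖y‖ ≤ ‖z‖ → φ z ≤ φ y)
    (hsupp : closure (Function.support φ) = Metric.closedBall 0 3)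
    (s : SignedMeasure (Euc d))
    (H : ∃ C : ℝ, 0 < C ∧ ∀ (n : ℕ) (x : Fin n → Euc d) (r : Fin n → ℝ),
      (∀ i, 0 < r i) → (∀ i, r i < 1) →
      (Pairwise fun i j => Disjoint (Metric.ball (x i) (r i)) (Metric.ball (x j) (r j))) →
      ENNReal.ofReal |∑ i : Fin n, signedIntegral s (fun y => φ ((r i)⁻¹ • (y - x i)))|
        ≤ ENNReal.ofReal C * ((lorentzSeqNorm α q r) ^ q) ^ γ) :
    ∃ C' : ℝ, 0 < C' ∧ ∀ A : Set (Euc d), MeasurableSet A →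
      s.totalVariation A ≤ ENNReal.ofReal C' * (NHfin d α (q / α) A) ^ γ := by
  obtain ⟨C, hC, H⟩ := H
  obtain ⟨K1, hK1, h1⟩ := core α q γ hα hq hγ φ hbdd hpos hmono hsupp
    s.toJordanDecomposition.posPart s.toJordanDecomposition.negPart
    s.toJordanDecomposition.mutuallySingular C H
  obtain ⟨K2, hK2, h2⟩ := core α q γ hα hq hγ φ hbdd hpos hmono hsupp
    s.toJordanDecomposition.negPart s.toJordanDecomposition.posPart
    s.toJordanDecomposition.mutuallySingular.symm C (by
      intro n x r h0 h1 hd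
      refine le_trans (le_of_eq ?_) (H n x r h0 h1 hd)
      rw [← abs_neg, ← Finset.sum_neg_distrib]
      simp only [signedIntegral, neg_sub])
  refine ⟨(K1 + K2).toReal + 1, by positivity, fun A _ => ?_⟩
  have hK : K1 + K2 ≤ ENNReal.ofReal ((K1 + K2).toReal + 1) := by
    rw [ENNReal.le_ofReal_iff_toReal_le (ENNReal.add_ne_top.2 ⟨hK1, hK2⟩) (by positivity)]
    linarith
  calc s.totalVariation A = s.toJordanDecomposition.posPart A +
        s.toJordanDecomposition.negPart A := rfl
    _ ≤ K1 * (NHfin d α (q / α) A) ^ γ + K2 * (NHfin d α (q / α) A) ^ γ :=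
        add_le_add (h1 A) (h2 A)
    _ = (K1 + K2) * (NHfin d α (q / α) A) ^ γ := by rw [add_mul]
    _ ≤ _ := by gcongr
end
end
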